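/- arXiv:2602.08498 — 3 statements merged into one kernel-verified Lean document; each statement's English description precedes it below -/
import Mathlib

section
/- Policy Difference Lemma: for any two policies π̃ and π and any start state s₀, V^{π̃} s₀ − V^π s₀ = (1/(1−γ)) · ∑_s d_{s₀}^{π̃} s · ∑_a π̃ s a · A^π s a. -/
open scoped BigOperators

variable {S A : Type*}

/-- Induced state-transition matrix of a policy: `(Pmat P pol) s s' = ∑ a, pol s a * P s a s'`. -/
noncomputable def Pmat [Fintype A] (P : S → A → S → ℝ) (pol : S → A → ℝ) :
    Matrix S S ℝ :=
  Matrix.of fun s s' => ∑ a, pol s a * P s a s'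

/-- Induced reward vector of a policy: `(rvec r pol) s = ∑ a, pol s a * r s a`. -/
noncomputable def rvec [Fintype A] (r : S → A → ℝ) (pol : S → A → ℝ) : S → ℝ :=
  fun s => ∑ a, pol s a * r s a

/-- Value function: `V^π s = ∑' t, γ^t * ((P_π)^t r_π) s`. -/
noncomputable def Vval [Fintype S] [DecidableEq S] [Fintype A]
    (P : S → A → S → ℝ) (r : S → A → ℝ) (γ : ℝ) (pol : S → A → ℝ) : S → ℝ :=
  fun s => ∑' t : ℕ, γ ^ t * ((Pmat P pol ^ t).mulVec (rvec r pol)) s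

/-- Action-value function: `Q^π s a = r s a + γ * ∑ s', P s a s' * V^π s'`. -/
noncomputable def Qval [Fintype S] [DecidableEq S] [Fintype A]
    (P : S → A → S → ℝ) (r : S → A → ℝ) (γ : ℝ) (pol : S → A → ℝ) : S → A → ℝ :=
  fun s a => r s a + γ * ∑ s', P s a s' * Vval P r γ pol s'

/-- Advantage function: `A^π s a = Q^π s a - V^π s`. -/
noncomputable def Adv [Fintype S] [DecidableEq S] [Fintype A]
    (P : S → A → S → ℝ) (r : S → A → ℝ) (γ : ℝ) (pol : S → A → ℝ) : S → A → ℝ :=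
  fun s a => Qval P r γ pol s a - Vval P r γ pol s

/-- Discounted state-visitation distribution from start state `s₀`. -/
noncomputable def dvisit [Fintype S] [DecidableEq S] [Fintype A]
    (P : S → A → S → ℝ) (γ : ℝ) (pol : S → A → ℝ) (s₀ : S) : S → ℝ :=
  fun s => (1 - γ) * ∑' t : ℕ, γ ^ t * (Pmat P pol ^ t) s₀ s

/-- Discounted state-visitation distribution under an initial distribution `ρ`. -/
noncomputable def dvisitInit [Fintype S] [DecidableEq S] [Fintype A]
    (P : S → A → S → ℝ) (γ : ℝ) (pol : S → A → ℝ) (ρ : S → ℝ) : S → ℝ :=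
  fun s => ∑ s₀, ρ s₀ * dvisit P γ pol s₀ s

/-- Potential-based shaped reward:
`r' s a = r s a + α * (γ * ∑ s', P s a s' * Φ s' - Φ s)`. -/
noncomputable def shaped [Fintype S] (P : S → A → S → ℝ) (r : S → A → ℝ) (γ : ℝ)
    (Φ : S → ℝ) (α : ℝ) : S → A → ℝ :=
  fun s a => r s a + α * (γ * ∑ s', P s a s' * Φ s' - Φ s)

/-- Softmax distribution on a finite type. -/
noncomputable def softmax [Fintype A] (θ : A → ℝ) (a : A) : ℝ :=
  Real.exp (θ a) / ∑ b, Real.exp (θ b)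

/-- Partition function of the exponentially tilted (NPG) update. -/
noncomputable def Zfun [Fintype S] [DecidableEq S] [Fintype A]
    (P : S → A → S → ℝ) (r : S → A → ℝ) (γ : ℝ) (pol : S → A → ℝ)
    (F : S → A → ℝ) (α β : ℝ) (s : S) : ℝ :=
  ∑ a, pol s a * Real.exp (β * (Adv P r γ pol s a + α * F s a) / (1 - γ))

/-- Exponentially tilted (NPG) policy update. -/
noncomputable def tilted [Fintype S] [DecidableEq S] [Fintype A]
    (P : S → A → S → ℝ) (r : S → A → ℝ) (γ : ℝ) (pol : S → A → ℝ)
    (F : S → A → ℝ) (α β : ℝ) (s : S) (a : A) : ℝ :=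
  pol s a * Real.exp (β * (Adv P r γ pol s a + α * F s a) / (1 - γ)) /
    Zfun P r γ pol F α β s


lemma Pmat_mem_rowStochastic [Fintype S] [DecidableEq S] [Fintype A]
    {P : S → A → S → ℝ} (hP0 : ∀ s a s', 0 ≤ P s a s') (hP1 : ∀ s a, ∑ s', P s a s' = 1)
    {pol : S → A → ℝ} (hpol0 : ∀ s a, 0 ≤ pol s a) (hpol1 : ∀ s, ∑ a, pol s a = 1) :
    Pmat P pol ∈ Matrix.rowStochastic ℝ S := by
  rw [Matrix.mem_rowStochastic_iff_sum]
  refine ⟨fun s s' => Finset.sum_nonneg fun a _ => mul_nonneg (hpol0 s a) (hP0 s a s'),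
    fun s => ?_⟩
  simp only [Pmat, Matrix.of_apply]
  rw [Finset.sum_comm]
  simp [← Finset.mul_sum, hP1, hpol1]

lemma summable_pow_mul_rowStochastic_pow [Fintype S] [DecidableEq S] {M : Matrix S S ℝ}
    (hM : M ∈ Matrix.rowStochastic ℝ S) {γ : ℝ} (hγ0 : 0 ≤ γ) (hγ1 : γ < 1) (s s' : S) :
    Summable fun t : ℕ => γ ^ t * (M ^ t) s s' := by
  have hMt (t : ℕ) : M ^ t ∈ Matrix.rowStochastic ℝ S := pow_mem hM t
  refine Summable.of_nonneg_of_le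
    (fun t => mul_nonneg (pow_nonneg hγ0 t) (Matrix.nonneg_of_mem_rowStochastic (hMt t)))
    (fun t => mul_le_of_le_one_right (pow_nonneg hγ0 t)
      (Matrix.le_one_of_mem_rowStochastic (hMt t)))
    (summable_geometric_of_lt_one hγ0 hγ1)

lemma tsum_pow_mul_mulVec_apply [Fintype S] [DecidableEq S] {M : Matrix S S ℝ} {γ : ℝ} {s₀ : S}
    (h : ∀ s, Summable fun t : ℕ => γ ^ t * (M ^ t) s₀ s) (v : S → ℝ) :
    ∑' t : ℕ, γ ^ t * ((M ^ t).mulVec v) s₀ = ∑ s, (∑' t : ℕ, γ ^ t * (M ^ t) s₀ s) * v s := by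
  simp_rw [← tsum_mul_right]
  rw [← Summable.tsum_finsetSum fun s _ => (h s).mul_right (v s)]
  simp only [Matrix.mulVec, dotProduct, Finset.mul_sum, mul_assoc]

/-- The discounted occupancy inverts `1 - γ M`: pairing it with `v - γ M v` returns `v s₀`. -/
lemma sum_tsum_pow_mul_sub_mulVec [Fintype S] [DecidableEq S] {M : Matrix S S ℝ} {γ : ℝ} {s₀ : S}
    (h : ∀ s, Summable fun t : ℕ => γ ^ t * (M ^ t) s₀ s) (v : S → ℝ) :
    ∑ s, (∑' t : ℕ, γ ^ t * (M ^ t) s₀ s) * (v s - γ * M.mulVec v s) = v s₀ := by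
  have hv : Summable fun t : ℕ => γ ^ t * ((M ^ t).mulVec v) s₀ := by
    simpa only [Matrix.mulVec, dotProduct, Finset.mul_sum, mul_assoc] using
      summable_sum (s := Finset.univ) fun s _ => (h s).mul_right (v s)
  simp only [mul_sub, Finset.sum_sub_distrib]
  simp only [mul_left_comm _ γ, ← Finset.mul_sum]
  rw [← tsum_pow_mul_mulVec_apply h, ← tsum_pow_mul_mulVec_apply h, hv.tsum_eq_zero_add,
    ← tsum_mul_left]
  simp [Matrix.mulVec_mulVec, pow_succ, mul_assoc, mul_left_comm]

lemma sum_mul_Adv [Fintype S] [DecidableEq S] [Fintype A]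
    (P : S → A → S → ℝ) (r : S → A → ℝ) (γ : ℝ) (pol pol' : S → A → ℝ) {s : S}
    (hpol : ∑ a, pol s a = 1) :
    ∑ a, pol s a * Adv P r γ pol' s a =
      rvec r pol s -
        (Vval P r γ pol' s - γ * (Pmat P pol).mulVec (Vval P r γ pol') s) := by
  have hmul : (Pmat P pol).mulVec (Vval P r γ pol') s =
      ∑ a, pol s a * ∑ s', P s a s' * Vval P r γ pol' s' := by
    simp only [Matrix.mulVec, dotProduct, Pmat, Matrix.of_apply, Finset.sum_mul, Finset.mul_sum,
      mul_assoc]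
    exact Finset.sum_comm
  simp only [Adv, Qval, mul_sub, mul_add, Finset.sum_sub_distrib, Finset.sum_add_distrib,
    ← Finset.sum_mul, hpol, hmul, rvec, mul_left_comm _ γ, ← Finset.mul_sum]
  ring

theorem policy_difference_lemma [Fintype S] [DecidableEq S] [Nonempty S] [Fintype A] [Nonempty A]
    (P : S → A → S → ℝ) (hP0 : ∀ s a s', 0 ≤ P s a s') (hP1 : ∀ s a, ∑ s', P s a s' = 1)
    (r : S → A → ℝ) (γ : ℝ) (hγ0 : 0 ≤ γ) (hγ1 : γ < 1)
    (πt : S → A → ℝ) (hπt0 : ∀ s a, 0 ≤ πt s a) (hπt1 : ∀ s, ∑ a, πt s a = 1)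
    (π : S → A → ℝ) (hπ0 : ∀ s a, 0 ≤ π s a) (hπ1 : ∀ s, ∑ a, π s a = 1)
    (s₀ : S) :
    Vval P r γ πt s₀ - Vval P r γ π s₀ =
      (1 / (1 - γ)) * ∑ s, dvisit P γ πt s₀ s * ∑ a, πt s a * Adv P r γ π s a := by
  have hsum := summable_pow_mul_rowStochastic_pow
    (Pmat_mem_rowStochastic hP0 hP1 hπt0 hπt1) hγ0 hγ1 s₀
  have hγ : 1 - γ ≠ 0 := (sub_pos.2 hγ1).ne'
  simp only [sum_mul_Adv P r γ πt π (hπt1 _), dvisit, mul_assoc, ← Finset.mul_sum]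
  rw [← mul_assoc, one_div_mul_cancel hγ, one_mul]
  simp only [mul_sub _ (rvec r πt _), Finset.sum_sub_distrib]
  rw [sum_tsum_pow_mul_sub_mulVec hsum, ← tsum_pow_mul_mulVec_apply hsum]
  rfl
end

section
/- Shifting a solution of the Bellman optimality equation by the potential solves the shaped Bellman optimality equation: if Q : S → A → ℝ satisfies Q s a = r s a + γ · ∑_{s'} P s a s' · max_{a'} Q s' a' for all s, a, then the function Q̂ defined by Q̂ s a = Q s a − α · Φ s satisfies Q̂ s a = r' s a + γ · ∑_{s'} P s a s' · max_{a'} Q̂ s' a' for all s, a, where max_{a'} denotes the maximum over the finite nonempty action type A. -/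
open scoped BigOperators

variable {S A : Type*}

theorem Finset.sup'_sub_const {ι : Type*} {s : Finset ι} (hs : s.Nonempty) (f : ι → ℝ) (c : ℝ) :
    (s.sup' hs fun i => f i - c) = s.sup' hs f - c := by
  apply le_antisymm
  · exact Finset.sup'_le hs _ fun i hi => sub_le_sub_right (Finset.le_sup' f hi) c
  · rw [sub_le_iff_le_add]
    exact Finset.sup'_le hs _ fun i hi =>
      sub_le_iff_le_add.mp (Finset.le_sup' (fun i => f i - c) hi)

theorem shifted_solves_shaped_bellman_optimality [Fintype S] [DecidableEq S] [Nonempty S] [Fintype A] [Nonempty A]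
    (P : S → A → S → ℝ) (hP0 : ∀ s a s', 0 ≤ P s a s') (hP1 : ∀ s a, ∑ s', P s a s' = 1)
    (r : S → A → ℝ) (γ : ℝ) (hγ0 : 0 ≤ γ) (hγ1 : γ < 1)
    (Φ : S → ℝ) (α : ℝ)
    (Q : S → A → ℝ)
    (hQ : ∀ s a, Q s a = r s a + γ * ∑ s', P s a s' *
        (Finset.univ.sup' Finset.univ_nonempty fun a' => Q s' a')) :
    ∀ s a, Q s a - α * Φ s = shaped P r γ Φ α s a + γ * ∑ s', P s a s' *
        (Finset.univ.sup' Finset.univ_nonempty fun a' => Q s' a' - α * Φ s') := by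
  intro s a
  have h_sum : ∑ s', P s a s' * (α * Φ s') = α * ∑ s', P s a s' * Φ s' := by
    rw [Finset.mul_sum]
    exact Finset.sum_congr rfl fun s' _ => by ring
  simp only [Finset.sup'_sub_const, mul_sub, Finset.sum_sub_distrib, h_sum, shaped]
  rw [hQ s a]
  ring
end

section
/- Characterization of minimizers of the compatible-function-approximation loss: assume π s a > 0 for all s, a and d : S → ℝ satisfies d s > 0 for all s. Given α ∈ ℝ and F : S → A → ℝ, set u s a = A^π s a + α · F s a and define, for w : S → A → ℝ, L(w) = ∑_s d s · ∑_a π s a · (w s a − ∑_{a'} π s a' · w s a' − u s a)². Then w minimizes L over all functions S → A → ℝ if and only if there exists c : S → ℝ such that w s a = u s a + c s for all s, a. -/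
open scoped BigOperators

variable {S A : Type*}

/-- Bias-variance decomposition of the weighted compatible loss at a single state. -/
lemma sum_mul_centered_sub_sq [Fintype A] (p w u : A → ℝ) (hp : ∑ a, p a = 1) :
    ∑ a, p a * (w a - (∑ b, p b * w b) - u a) ^ 2 =
      ∑ a, p a * (w a - u a - ∑ b, p b * (w b - u b)) ^ 2 + (∑ b, p b * u b) ^ 2 := by
  set m := ∑ b, p b * (w b - u b) with hm
  set v := ∑ b, p b * u b
  have hw : ∑ b, p b * w b = m + v := by
    rw [hm, ← Finset.sum_add_distrib]
    exact Finset.sum_congr rfl fun b _ => by ring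
  have hcentered : ∑ a, p a * (w a - u a - m) = 0 := by
    simp only [mul_sub _ _ m, Finset.sum_sub_distrib, ← Finset.sum_mul, hp, ← hm, one_mul, sub_self]
  calc ∑ a, p a * (w a - (∑ b, p b * w b) - u a) ^ 2
      = ∑ a, (p a * (w a - u a - m) ^ 2 - 2 * v * (p a * (w a - u a - m)) + p a * v ^ 2) :=
        Finset.sum_congr rfl fun a _ => by rw [hw]; ring
    _ = ∑ a, p a * (w a - u a - m) ^ 2 + v ^ 2 := by
        rw [Finset.sum_add_distrib, Finset.sum_sub_distrib, ← Finset.mul_sum, ← Finset.sum_mul,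
          hcentered, hp]
        ring

/-- The minimizers of the compatible loss with an arbitrary target `u` are exactly the translates
of `u` by functions of the state. -/
lemma forall_compatible_loss_le_iff [Fintype S] [Fintype A]
    (p : S → A → ℝ) (hp : ∀ s a, 0 < p s a) (hp1 : ∀ s, ∑ a, p s a = 1)
    (d : S → ℝ) (hd : ∀ s, 0 < d s) (u w : S → A → ℝ) :
    (∀ w' : S → A → ℝ,
        (∑ s, d s * ∑ a, p s a * (w s a - (∑ b, p s b * w s b) - u s a) ^ 2) ≤
        (∑ s, d s * ∑ a, p s a * (w' s a - (∑ b, p s b * w' s b) - u s a) ^ 2)) ↔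
      ∃ c : S → ℝ, ∀ s a, w s a = u s a + c s := by
  have hvar (f : S → A → ℝ) (s : S) :
      0 ≤ ∑ a, p s a * (f s a - u s a - ∑ b, p s b * (f s b - u s b)) ^ 2 :=
    Finset.sum_nonneg fun a _ => mul_nonneg (hp s a).le (sq_nonneg _)
  simp only [fun (f : S → A → ℝ) s => sum_mul_centered_sub_sq (p s) (f s) (u s) (hp1 s),
    mul_add (d _), Finset.sum_add_distrib, add_le_add_iff_right]
  constructor
  · intro h
    have hle := h u
    simp only [sub_self, mul_zero, Finset.sum_const_zero, ne_eq, OfNat.ofNat_ne_zero,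
      not_false_eq_true, zero_pow] at hle
    have hnonneg (s : S) := mul_nonneg (hd s).le (hvar w s)
    have hzero := (Finset.sum_eq_zero_iff_of_nonneg fun s _ => hnonneg s).1
      (le_antisymm hle (Finset.sum_nonneg fun s _ => hnonneg s))
    refine ⟨fun s => ∑ b, p s b * (w s b - u s b), fun s a => ?_⟩
    have hs := (mul_eq_zero.1 (hzero s (Finset.mem_univ s))).resolve_left (hd s).ne'
    have ha := (Finset.sum_eq_zero_iff_of_nonneg fun a _ =>
      mul_nonneg (hp s a).le (sq_nonneg _)).1 hs a (Finset.mem_univ a)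
    have hsq := pow_eq_zero_iff two_ne_zero |>.1 ((mul_eq_zero.1 ha).resolve_left (hp s a).ne')
    linarith
  · rintro ⟨c, hc⟩ w'
    refine Finset.sum_le_sum fun s _ => mul_le_mul_of_nonneg_left ?_ (hd s).le
    have hw : ∑ a, p s a * (w s a - u s a - ∑ b, p s b * (w s b - u s b)) ^ 2 = 0 := by
      simp [hc, ← Finset.sum_mul, hp1]
    exact hw.trans_le (hvar w' s)

theorem compatible_loss_minimizers [Fintype S] [DecidableEq S] [Nonempty S] [Fintype A] [Nonempty A]
    (P : S → A → S → ℝ) (hP0 : ∀ s a s', 0 ≤ P s a s') (hP1 : ∀ s a, ∑ s', P s a s' = 1)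
    (r : S → A → ℝ) (γ : ℝ) (hγ0 : 0 ≤ γ) (hγ1 : γ < 1)
    (π : S → A → ℝ) (hπpos : ∀ s a, 0 < π s a) (hπ1 : ∀ s, ∑ a, π s a = 1)
    (d : S → ℝ) (hd : ∀ s, 0 < d s)
    (α : ℝ) (F : S → A → ℝ)
    (w : S → A → ℝ) :
    (∀ w' : S → A → ℝ,
        (∑ s, d s * ∑ a, π s a *
          (w s a - (∑ a', π s a' * w s a') - (Adv P r γ π s a + α * F s a)) ^ 2) ≤
        (∑ s, d s * ∑ a, π s a *
          (w' s a - (∑ a', π s a' * w' s a') - (Adv P r γ π s a + α * F s a)) ^ 2)) ↔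
      ∃ c : S → ℝ, ∀ s a, w s a = (Adv P r γ π s a + α * F s a) + c s := by
  exact forall_compatible_loss_le_iff π hπpos hπ1 d hd
    (fun s a => Adv P r γ π s a + α * F s a) w
end
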